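/- Fix an integer ℓ > 2 and a residue i with 0 ≤ i < ℓ. If λ is an ℓ-core, then \hatφ_i(λ) = φ_i(λ) and \hat f_i^{\hatφ_i(λ)} λ = \tilde f_i^{φ_i(λ)} λ. Consequently, every ℓ-core is a node of the ladder crystal B(Λ0)^L. -/

import Mathlib

noncomputable section

/-!
Common combinatorial definitions: partitions (English notation, rows indexed from 1),
Young diagrams, hooks, rim hooks, ladders, residues, crystal operators (classical and
ladder versions), locked boxes, regularization classes, dominance order.
-/

structure YPartition where
  part : ℕ → ℕ
  zero_at_zero : part 0 = 0
  antitone : ∀ i j : ℕ, 1 ≤ i → i ≤ j → part j ≤ part i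
  eventually_zero : ∃ N : ℕ, ∀ i : ℕ, N ≤ i → part i = 0

namespace YPartition

/-- The set of boxes of the Young diagram of `μ` (row, column), both indices ≥ 1. -/
def cells (μ : YPartition) : Set (ℕ × ℕ) :=
  {p | 1 ≤ p.1 ∧ 1 ≤ p.2 ∧ p.2 ≤ μ.part p.1}

/-- The length of column `b`: the number of rows containing a box in column `b`. -/
def colLen (μ : YPartition) (b : ℕ) : ℕ :=
  Nat.card {a : ℕ | 1 ≤ a ∧ b ≤ μ.part a}

/-- The arm of box `(a,b)`: boxes strictly to its right in its row. -/
def arm (μ : YPartition) (a b : ℕ) : ℕ := μ.part a - b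

/-- The leg of box `(a,b)`: boxes strictly below it in its column. -/
def leg (μ : YPartition) (a b : ℕ) : ℕ := μ.colLen b - a

/-- The hook length of the box `(a,b)`: arm + leg + 1. -/
def hook (μ : YPartition) (a b : ℕ) : ℕ := (μ.part a - b) + (μ.colLen b - a) + 1

/-- The number of boxes of `μ`. -/
def size (μ : YPartition) : ℕ := μ.cells.ncard

/-- The number of (nonzero) parts of `μ`. -/
def length (μ : YPartition) : ℕ := μ.colLen 1

/-- `μ` is an `(ℓ,0)`-JM partition: there are no boxes `(a,b)`, `(a,y)`, `(x,b)` with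
`ℓ ∣ hook (a,b)` while `ℓ` divides neither `hook (a,y)` nor `hook (x,b)`. -/
def IsJM (ℓ : ℕ) (μ : YPartition) : Prop :=
  ¬ ∃ a b y x : ℕ, (a, b) ∈ μ.cells ∧ (a, y) ∈ μ.cells ∧ (x, b) ∈ μ.cells ∧
    ℓ ∣ μ.hook a b ∧ ¬ ℓ ∣ μ.hook a y ∧ ¬ ℓ ∣ μ.hook x b

/-- Two boxes share an edge. -/
def BoxAdjacent (p q : ℕ × ℕ) : Prop :=
  (p.1 = q.1 ∧ (p.2 + 1 = q.2 ∨ q.2 + 1 = p.2)) ∨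
  (p.2 = q.2 ∧ (p.1 + 1 = q.1 ∨ q.1 + 1 = p.1))

/-- A set of boxes is connected (via shared edges, inside the set). -/
def SetConnected (S : Set (ℕ × ℕ)) : Prop :=
  ∀ p ∈ S, ∀ q ∈ S,
    Relation.ReflTransGen (fun x y => x ∈ S ∧ y ∈ S ∧ BoxAdjacent x y) p q

/-- `S` contains no 2 × 2 square of boxes. -/
def HasNoSquare (S : Set (ℕ × ℕ)) : Prop :=
  ¬ ∃ a b : ℕ, (a, b) ∈ S ∧ (a + 1, b) ∈ S ∧ (a, b + 1) ∈ S ∧ (a + 1, b + 1) ∈ S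

/-- `S` is a removable `ℓ`-rim hook of `μ`: a connected set of `ℓ` boxes of `μ` with no
2 × 2 square whose removal leaves the Young diagram of a partition. -/
def IsRimHook (ℓ : ℕ) (μ : YPartition) (S : Set (ℕ × ℕ)) : Prop :=
  S ⊆ μ.cells ∧ S.ncard = ℓ ∧ SetConnected S ∧ HasNoSquare S ∧
    ∃ ν : YPartition, ν.cells = μ.cells \ S

/-- `S` is contained in a single row. -/
def HorizontalHook (S : Set (ℕ × ℕ)) : Prop := ∃ a : ℕ, ∀ p ∈ S, p.1 = a

/-- `S` is contained in a single column. -/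
def VerticalHook (S : Set (ℕ × ℕ)) : Prop := ∃ b : ℕ, ∀ p ∈ S, p.2 = b

/-- Two sets of boxes are adjacent when some box of one shares an edge with a box of the other. -/
def SetsAdjacent (R S : Set (ℕ × ℕ)) : Prop := ∃ p ∈ R, ∃ q ∈ S, BoxAdjacent p q

/-- An `ℓ`-core: a partition with no removable `ℓ`-rim hook. -/
def IsCore (ℓ : ℕ) (μ : YPartition) : Prop := ¬ ∃ S : Set (ℕ × ℕ), IsRimHook ℓ μ S

/-- `p` and `q` lie on the same ladder: going down one column step the row increases
by `ℓ - 1`. -/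
def SameLadder (ℓ : ℕ) (p q : ℕ × ℕ) : Prop :=
  (q.1 : ℤ) - (p.1 : ℤ) = ((ℓ : ℤ) - 1) * ((p.2 : ℤ) - (q.2 : ℤ))

/-- The index of the ladder through `p`: the ladder through `(k,1)` has index `k`. -/
def ladderIdx (ℓ : ℕ) (p : ℕ × ℕ) : ℕ := p.1 + (ℓ - 1) * (p.2 - 1)

/-- The residue of position `(a,b)` is `b - a` mod `ℓ`. -/
def res (ℓ : ℕ) (p : ℕ × ℕ) : ℕ := (((p.2 : ℤ) - (p.1 : ℤ)) % (ℓ : ℤ)).toNat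

/-- `p` is a removable box of `μ`. -/
def Removable (μ : YPartition) (p : ℕ × ℕ) : Prop :=
  1 ≤ p.1 ∧ p.2 = μ.part p.1 ∧ μ.part (p.1 + 1) < p.2

/-- `p` is an addable box of `μ`. -/
def Addable (μ : YPartition) (p : ℕ × ℕ) : Prop :=
  1 ≤ p.1 ∧ p.2 = μ.part p.1 + 1 ∧ (p.1 = 1 ∨ p.2 ≤ μ.part (p.1 - 1))

/-- The removable `i`-boxes of `μ`. -/
def RemovableRes (ℓ i : ℕ) (μ : YPartition) : Set (ℕ × ℕ) :=
  {p | Removable μ p ∧ res ℓ p = i}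

/-- The addable `i`-boxes of `μ`. -/
def AddableRes (ℓ i : ℕ) (μ : YPartition) : Set (ℕ × ℕ) :=
  {p | Addable μ p ∧ res ℓ p = i}

/-- Ladder reading order (reflexive): ladders left to right, top to bottom within a ladder.
`LadderLE ℓ p q` means `p` is read before (or equal to) `q`. -/
def LadderLE (ℓ : ℕ) (p q : ℕ × ℕ) : Prop :=
  ladderIdx ℓ p < ladderIdx ℓ q ∨ (ladderIdx ℓ p = ladderIdx ℓ q ∧ p.1 ≤ q.1)

/-- Strict ladder reading order. -/
def LadderLT (ℓ : ℕ) (p q : ℕ × ℕ) : Prop :=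
  ladderIdx ℓ p < ladderIdx ℓ q ∨ (ladderIdx ℓ p = ladderIdx ℓ q ∧ p.1 < q.1)

/-- Classical reading order (reflexive): rows from bottom to top.
`RowLE p q` means `p` is read before (or equal to) `q`. -/
def RowLE (p q : ℕ × ℕ) : Prop := q.1 ≤ p.1

/-- Given a reading order `le`, a set `Rem` of `-` marks and `Add` of `+` marks, a `-` at `p`
survives the cancellation of adjacent `-+` pairs iff every interval of the reading word
starting at `p` contains strictly more `-`'s than `+`'s. -/
def NormalIn (le : ℕ × ℕ → ℕ × ℕ → Prop) (Rem Add : Set (ℕ × ℕ)) (p : ℕ × ℕ) : Prop :=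
  p ∈ Rem ∧ ∀ q ∈ Rem ∪ Add, le p q →
    (Add ∩ {s | le p s ∧ le s q}).ncard < (Rem ∩ {s | le p s ∧ le s q}).ncard

/-- A `+` at `q` survives the cancellation of adjacent `-+` pairs iff every interval of the
reading word ending at `q` contains strictly more `+`'s than `-`'s. -/
def ConormalIn (le : ℕ × ℕ → ℕ × ℕ → Prop) (Rem Add : Set (ℕ × ℕ)) (q : ℕ × ℕ) : Prop :=
  q ∈ Add ∧ ∀ p ∈ Rem ∪ Add, le p q →
    (Rem ∩ {s | le p s ∧ le s q}).ncard < (Add ∩ {s | le p s ∧ le s q}).ncard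

/-- Ladder normal `i`-box. -/
def LadderNormal (ℓ i : ℕ) (μ : YPartition) (p : ℕ × ℕ) : Prop :=
  NormalIn (LadderLE ℓ) (RemovableRes ℓ i μ) (AddableRes ℓ i μ) p

/-- Ladder conormal `i`-box. -/
def LadderConormal (ℓ i : ℕ) (μ : YPartition) (p : ℕ × ℕ) : Prop :=
  ConormalIn (LadderLE ℓ) (RemovableRes ℓ i μ) (AddableRes ℓ i μ) p

/-- Normal `i`-box (classical signature). -/
def ClassNormal (ℓ i : ℕ) (μ : YPartition) (p : ℕ × ℕ) : Prop :=
  NormalIn RowLE (RemovableRes ℓ i μ) (AddableRes ℓ i μ) p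

/-- Conormal `i`-box (classical signature). -/
def ClassConormal (ℓ i : ℕ) (μ : YPartition) (p : ℕ × ℕ) : Prop :=
  ConormalIn RowLE (RemovableRes ℓ i μ) (AddableRes ℓ i μ) p

/-- `ε̂_i(μ)`: number of ladder normal `i`-boxes. -/
def hatEps (ℓ i : ℕ) (μ : YPartition) : ℕ := {p | LadderNormal ℓ i μ p}.ncard

/-- `φ̂_i(μ)`: number of ladder conormal `i`-boxes. -/
def hatPhi (ℓ i : ℕ) (μ : YPartition) : ℕ := {p | LadderConormal ℓ i μ p}.ncard

/-- `ε_i(μ)`: number of normal `i`-boxes. -/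
def eps (ℓ i : ℕ) (μ : YPartition) : ℕ := {p | ClassNormal ℓ i μ p}.ncard

/-- `φ_i(μ)`: number of conormal `i`-boxes. -/
def phi (ℓ i : ℕ) (μ : YPartition) : ℕ := {p | ClassConormal ℓ i μ p}.ncard

/-- The ladder good `i`-box: the leftmost `-` of the reduced ladder `i`-signature. -/
def LadderGood (ℓ i : ℕ) (μ : YPartition) (p : ℕ × ℕ) : Prop :=
  LadderNormal ℓ i μ p ∧ ∀ q, LadderNormal ℓ i μ q → LadderLE ℓ p q

/-- The ladder cogood `i`-box: the rightmost `+` of the reduced ladder `i`-signature. -/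
def LadderCogood (ℓ i : ℕ) (μ : YPartition) (p : ℕ × ℕ) : Prop :=
  LadderConormal ℓ i μ p ∧ ∀ q, LadderConormal ℓ i μ q → LadderLE ℓ q p

/-- The good `i`-box (classical). -/
def ClassGood (ℓ i : ℕ) (μ : YPartition) (p : ℕ × ℕ) : Prop :=
  ClassNormal ℓ i μ p ∧ ∀ q, ClassNormal ℓ i μ q → RowLE p q

/-- The cogood `i`-box (classical). -/
def ClassCogood (ℓ i : ℕ) (μ : YPartition) (p : ℕ × ℕ) : Prop :=
  ClassConormal ℓ i μ p ∧ ∀ q, ClassConormal ℓ i μ q → RowLE q p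

/-- The ladder crystal operator `f̂_i` as a relation: `mu = f̂_i lam ≠ 0`. -/
def HatF (ℓ i : ℕ) (lam mu : YPartition) : Prop :=
  ∃ p, LadderCogood ℓ i lam p ∧ mu.cells = insert p lam.cells

/-- The ladder crystal operator `ê_i` as a relation: `mu = ê_i lam ≠ 0`. -/
def HatE (ℓ i : ℕ) (lam mu : YPartition) : Prop :=
  ∃ p, LadderGood ℓ i lam p ∧ mu.cells = lam.cells \ {p}

/-- The classical crystal operator `f̃_i` as a relation: `mu = f̃_i lam ≠ 0`. -/
def TildeF (ℓ i : ℕ) (lam mu : YPartition) : Prop :=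
  ∃ p, ClassCogood ℓ i lam p ∧ mu.cells = insert p lam.cells

/-- The classical crystal operator `ẽ_i` as a relation: `mu = ẽ_i lam ≠ 0`. -/
def TildeE (ℓ i : ℕ) (lam mu : YPartition) : Prop :=
  ∃ p, ClassGood ℓ i lam p ∧ mu.cells = lam.cells \ {p}

/-- `n`-fold composition of a relation. -/
def RelIter {α : Type} (r : α → α → Prop) : ℕ → α → α → Prop
  | 0 => fun a b => a = b
  | n + 1 => fun a b => ∃ c, r a c ∧ RelIter r n c b

/-- The empty partition. -/
def emptyP : YPartition where
  part := fun _ => 0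
  zero_at_zero := rfl
  antitone := fun _ _ _ _ => le_rfl
  eventually_zero := ⟨0, fun _ _ => rfl⟩

/-- `μ` is a node of the ladder crystal `B(Λ₀)^L`: it is obtained from the empty
partition by finitely many applications of the operators `f̂_i`, `0 ≤ i < ℓ`. -/
def LadderNode (ℓ : ℕ) (μ : YPartition) : Prop :=
  Relation.ReflTransGen (fun a b => ∃ i : ℕ, i < ℓ ∧ HatF ℓ i a b) emptyP μ

/-- The type I locking condition at `(a,b)`: every unoccupied position on the ladder of
`(a,b)` lying below it has an unoccupied position directly above it. -/
def LadderClear (ℓ : ℕ) (μ : YPartition) (a b : ℕ) : Prop :=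
  ∀ c d : ℕ, 1 ≤ c → 1 ≤ d → SameLadder ℓ (a, b) (c, d) → a < c →
    (c, d) ∉ μ.cells → (c - 1, d) ∉ μ.cells

/-- Locked boxes of `μ`. -/
inductive Locked (ℓ : ℕ) (μ : YPartition) : ℕ × ℕ → Prop where
  | typeI_top : ∀ b : ℕ, (1, b) ∈ μ.cells → LadderClear ℓ μ 1 b → Locked ℓ μ (1, b)
  | typeI_up : ∀ a b : ℕ, (a + 1, b) ∈ μ.cells → Locked ℓ μ (a, b) →
      LadderClear ℓ μ (a + 1) b → Locked ℓ μ (a + 1, b)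
  | typeII : ∀ a b b' : ℕ, (a, b) ∈ μ.cells → b < b' → Locked ℓ μ (a, b') → Locked ℓ μ (a, b)

/-- Number of boxes of `μ` on the `k`-th ladder. -/
def ladderCount (ℓ : ℕ) (μ : YPartition) (k : ℕ) : ℕ :=
  (μ.cells ∩ {p | ladderIdx ℓ p = k}).ncard

/-- `lam` and `mu` lie in the same regularization class: they have the same number of
boxes on every ladder. -/
def SameRegClass (ℓ : ℕ) (lam mu : YPartition) : Prop :=
  ∀ k : ℕ, ladderCount ℓ lam k = ladderCount ℓ mu k

/-- The boxes of `μ` are top-justified on each ladder. -/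
def TopJustified (ℓ : ℕ) (μ : YPartition) : Prop :=
  ∀ p ∈ μ.cells, ∀ q : ℕ × ℕ, 1 ≤ q.1 → 1 ≤ q.2 →
    ladderIdx ℓ q = ladderIdx ℓ p → q.1 < p.1 → q ∈ μ.cells

/-- `mu = R lam`: the regularization of `lam`, obtained by moving every box of `lam` to
the topmost unoccupied positions of its ladder. -/
def IsRegularization (ℓ : ℕ) (lam mu : YPartition) : Prop :=
  SameRegClass ℓ lam mu ∧ TopJustified ℓ mu

/-- Dominance order on partitions. -/
def DomLE (lam mu : YPartition) : Prop :=
  ∀ j : ℕ, ∑ i ∈ Finset.Icc 1 j, lam.part i ≤ ∑ i ∈ Finset.Icc 1 j, mu.part i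

/-- All (positive) positions on the `k`-th ladder. -/
def LadderPositions (ℓ k : ℕ) : Set (ℕ × ℕ) :=
  {p | 1 ≤ p.1 ∧ 1 ≤ p.2 ∧ ladderIdx ℓ p = k}

/-- The set of locked boxes of `μ`. -/
def lockedCells (ℓ : ℕ) (μ : YPartition) : Set (ℕ × ℕ) := {p | Locked ℓ μ p}

/-- The number of unlocked boxes of `μ` on the `k`-th ladder. -/
def unlockedCount (ℓ : ℕ) (μ : YPartition) (k : ℕ) : ℕ :=
  ((μ.cells ∩ LadderPositions ℓ k) \ lockedCells ℓ μ).ncard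

/-- The diagram `S μ`: locked boxes stay put, and on each ladder the unlocked boxes are
moved into the lowest positions of that ladder not occupied by locked boxes. -/
def SCells (ℓ : ℕ) (μ : YPartition) : Set (ℕ × ℕ) :=
  lockedCells ℓ μ ∪
    {p | 1 ≤ p.1 ∧ 1 ≤ p.2 ∧ p ∉ lockedCells ℓ μ ∧
      ((LadderPositions ℓ (ladderIdx ℓ p) ∩ {q | p.1 < q.1}) \ lockedCells ℓ μ).ncard
        < unlockedCount ℓ μ (ladderIdx ℓ p)}

/-- `μ` is `ℓ`-regular: no part occurs `ℓ` or more times. -/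
def IsRegular (ℓ : ℕ) (μ : YPartition) : Prop :=
  ∀ a : ℕ, 1 ≤ a → 0 < μ.part (a + (ℓ - 1)) → μ.part (a + (ℓ - 1)) < μ.part a

/-- Removal of a single horizontal or vertical `ℓ`-rim hook. -/
def RemoveHV (ℓ : ℕ) (lam mu : YPartition) : Prop :=
  ∃ S : Set (ℕ × ℕ), IsRimHook ℓ lam S ∧ (HorizontalHook S ∨ VerticalHook S) ∧
    mu.cells = lam.cells \ S

/-- Condition (1): every removable `ℓ`-rim hook is horizontal or vertical. -/
def Cond1 (ℓ : ℕ) (μ : YPartition) : Prop :=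
  ∀ S : Set (ℕ × ℕ), IsRimHook ℓ μ S → HorizontalHook S ∨ VerticalHook S

/-- Condition (2): no vertical (resp. horizontal) `ℓ`-rim hook `R` of `μ` together with an
adjacent horizontal (resp. vertical) `ℓ`-rim hook `S` of `μ \ R` . -/
def Cond2 (ℓ : ℕ) (μ : YPartition) : Prop :=
  ¬ ∃ (R S : Set (ℕ × ℕ)) (ν : YPartition), IsRimHook ℓ μ R ∧ ν.cells = μ.cells \ R ∧
    IsRimHook ℓ ν S ∧ SetsAdjacent R S ∧
    ((VerticalHook R ∧ HorizontalHook S) ∨ (HorizontalHook R ∧ VerticalHook S))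

/-- A generalized `ℓ`-partition: conditions (1) and (2) hold after removing any sequence of
horizontal and vertical `ℓ`-rim hooks (including the empty sequence). -/
def IsGenLPartition (ℓ : ℕ) (lam : YPartition) : Prop :=
  ∀ mu : YPartition, Relation.ReflTransGen (RemoveHV ℓ) lam mu → Cond1 ℓ mu ∧ Cond2 ℓ mu

/-- The `t`-th row (from the top) of the bottom block of the decomposition
`(μ, r, s, ρ, σ)`: the number of values `v ∈ [1, s+1]` whose column block still reaches
row `t`; column block `v` consists of `σ_v·ℓ + (s+1−v)(ℓ−1)` rows of length `≥ v`. -/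
def bottomPart (ℓ s : ℕ) (σ : YPartition) (t : ℕ) : ℕ :=
  ((Finset.Icc 1 (s + 1)).filter fun v => t ≤ σ.part v * ℓ + (s + 1 - v) * (ℓ - 1)).card

/-- The `i`-th part of the partition corresponding to the data `(μ, r, s, ρ, σ)`. -/
def decompPart (ℓ : ℕ) (mu : YPartition) (r s : ℕ) (ρ σ : YPartition) (i : ℕ) : ℕ :=
  if i = 0 then 0
  else if i ≤ r + 1 then s + mu.part 1 + (r + 1 - i) * (ℓ - 1) + ρ.part i * ℓ
  else if i ≤ r + max mu.length 1 then s + mu.part (i - r)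
  else bottomPart ℓ s σ (i - (r + max mu.length 1))

/-- Admissibility of the decomposition data `(μ, r, s, ρ, σ)`. -/
def GoodData (ℓ : ℕ) (mu : YPartition) (r s : ℕ) (ρ σ : YPartition) : Prop :=
  IsCore ℓ mu ∧ mu.part 1 < mu.part 2 + (ℓ - 1) ∧ mu.colLen 1 < mu.colLen 2 + (ℓ - 1) ∧
  ρ.length ≤ r + 1 ∧ σ.length ≤ s + 1 ∧
  (mu.cells = ∅ → ρ.part (r + 1) = 0 ∨ σ.part (s + 1) = 0)

/-- `lam ≈ (μ, r, s, ρ, σ)`. -/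
def Decomposes (ℓ : ℕ) (lam mu : YPartition) (r s : ℕ) (ρ σ : YPartition) : Prop :=
  ∀ i : ℕ, lam.part i = decompPart ℓ mu r s ρ σ i

/-- Removal of a single `ℓ`-rim hook. -/
def RemoveHook (ℓ : ℕ) (lam mu : YPartition) : Prop :=
  ∃ S : Set (ℕ × ℕ), IsRimHook ℓ lam S ∧ mu.cells = lam.cells \ S

/-- `lam` has `ℓ`-core `nu` and `ℓ`-weight `w`. -/
def HasCoreAndWeight (ℓ : ℕ) (lam nu : YPartition) (w : ℕ) : Prop :=
  IsCore ℓ nu ∧ RelIter (RemoveHook ℓ) w lam nu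

/-- An L-partition. -/
def IsLPartition (ℓ : ℕ) (lam : YPartition) : Prop :=
  ¬ ∃ p : ℕ × ℕ, p ∈ lam.cells ∧ ℓ ∣ lam.hook p.1 p.2 ∧
    (lam.arm p.1 p.2 < (ℓ - 1) * lam.leg p.1 p.2 ∨
     lam.leg p.1 p.2 < (ℓ - 1) * lam.arm p.1 p.2)

end YPartition

open YPartition

theorem s10_res_eq {ℓ : ℕ} (hℓ : 2 < ℓ) {p q : ℕ × ℕ} (h : res ℓ p = res ℓ q) :
    ∃ k : ℤ, ((p.2 : ℤ) - p.1) - ((q.2 : ℤ) - q.1) = ℓ * k := by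
  unfold res at h
  have hl : (ℓ : ℤ) ≠ 0 := by omega
  have h1 := Int.emod_nonneg ((p.2 : ℤ) - p.1) hl
  have h2 := Int.emod_nonneg ((q.2 : ℤ) - q.1) hl
  have h3 : ((p.2 : ℤ) - p.1) % (ℓ : ℤ) = ((q.2 : ℤ) - q.1) % (ℓ : ℤ) := by omega
  exact Int.ModEq.dvd (Eq.symm h3 : _ ≡ _ [ZMOD (ℓ : ℤ)])

theorem s10_res_of {ℓ : ℕ} {p q : ℕ × ℕ} (k : ℤ)
    (h : ((p.2 : ℤ) - p.1) - ((q.2 : ℤ) - q.1) = ℓ * k) : res ℓ p = res ℓ q := by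
  unfold res
  have : ((p.2 : ℤ) - p.1) = ((q.2 : ℤ) - q.1) + ℓ * k := by linarith
  rw [this, Int.add_mul_emod_self_left]

theorem s10_res_lt {ℓ : ℕ} (hℓ : 2 < ℓ) (p : ℕ × ℕ) : res ℓ p < ℓ := by
  unfold res
  have h1 := Int.emod_nonneg ((p.2 : ℤ) - p.1) (b := (ℓ : ℤ)) (by omega)
  have h2 := Int.emod_lt_of_pos ((p.2 : ℤ) - p.1) (b := (ℓ : ℤ)) (by omega)
  omega

/-- positions whose contents differ by one have different residues -/
theorem s10_res_ne {ℓ : ℕ} (hℓ : 2 < ℓ) {p q : ℕ × ℕ}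
    (h : ((p.2 : ℤ) - p.1) - ((q.2 : ℤ) - q.1) = 1 ∨
      ((p.2 : ℤ) - p.1) - ((q.2 : ℤ) - q.1) = -1) : res ℓ p ≠ res ℓ q := by
  intro he
  obtain ⟨k, hk⟩ := s10_res_eq hℓ he
  have hd : (ℓ : ℤ) ∣ 1 := by
    rcases h with h | h
    · exact ⟨k, by omega⟩
    · exact ⟨-k, by rw [mul_neg]; omega⟩
  have := Int.le_of_dvd one_pos hd
  omega

theorem s10_addable_iff (μ : YPartition) (a b : ℕ) :
    Addable μ (a, b) ↔ 1 ≤ a ∧ 1 ≤ b ∧ (a, b) ∉ μ.cells ∧ (a = 1 ∨ (a - 1, b) ∈ μ.cells) ∧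
      (b = 1 ∨ (a, b - 1) ∈ μ.cells) := by
  simp only [Addable, cells, Set.mem_ofPred_eq]
  constructor
  · rintro ⟨h1, h2, h3⟩
    omega
  · rintro ⟨h1, h2, h3, h4, h5⟩
    omega

theorem s10_removable_iff (μ : YPartition) (a b : ℕ) :
    Removable μ (a, b) ↔ (a, b) ∈ μ.cells ∧ (a + 1, b) ∉ μ.cells ∧ (a, b + 1) ∉ μ.cells := by
  simp only [Removable, cells, Set.mem_ofPred_eq]
  constructor
  · rintro ⟨h1, h2, h3⟩
    omega
  · rintro ⟨h1, h2, h3⟩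
    omega

theorem s10_cells_inj {μ ν : YPartition} (h : μ.cells = ν.cells) : μ = ν := by
  have hp : μ.part = ν.part := by
    funext a
    rcases Nat.eq_zero_or_pos a with rfl | ha
    · rw [μ.zero_at_zero, ν.zero_at_zero]
    · have h1 : ∀ b, (a, b) ∈ μ.cells ↔ (a, b) ∈ ν.cells := fun b => by rw [h]
      simp only [cells, Set.mem_ofPred_eq] at h1
      have h2 := h1 (μ.part a)
      have h3 := h1 (ν.part a)
      omega
  cases μ; cases ν; simp at hp; subst hp; rfl

theorem s10_cells_finite (μ : YPartition) : μ.cells.Finite := by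
  obtain ⟨N, hN⟩ := μ.eventually_zero
  apply ((Set.finite_Iic N).prod (Set.finite_Iic (μ.part 1))).subset
  rintro ⟨a, b⟩ ⟨h1, h2, h3⟩
  simp only [Set.mem_prod, Set.mem_Iic] at *
  constructor
  · by_contra hc
    have := hN a (by omega)
    omega
  · exact h3.trans (μ.antitone 1 a le_rfl h1)

/-- build a partition from adjacent inequalities -/
def s10_mk (f : ℕ → ℕ) (h0 : f 0 = 0) (hs : ∀ a, 1 ≤ a → f (a + 1) ≤ f a)
    (he : ∃ N : ℕ, ∀ i : ℕ, N ≤ i → f i = 0) : YPartition where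
  part := f
  zero_at_zero := h0
  antitone := by
    intro i j hi hij
    induction j, hij using Nat.le_induction with
    | base => exact le_rfl
    | succ n hn ih => exact (hs n (by omega)).trans ih
  eventually_zero := he

theorem s10_exists_insert (μ : YPartition) (p : ℕ × ℕ) (hp : Addable μ p) :
    ∃ ν : YPartition, ν.cells = insert p μ.cells := by
  obtain ⟨a, b⟩ := p
  obtain ⟨h1, h2, h3⟩ := hp
  simp only at h1 h2 h3
  refine ⟨s10_mk (fun k => if k = a then b else μ.part k) ?_ ?_ ?_, ?_⟩
  · rw [if_neg (by omega)]; exact μ.zero_at_zero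
  · intro k hk
    have := μ.antitone k (k + 1) hk (by omega)
    split_ifs with g1 g2 g2
    · omega
    · subst g1
      simp at h3
      omega
    · subst g2; omega
    · exact this
  · obtain ⟨N, hN⟩ := μ.eventually_zero
    refine ⟨N + a + 1, fun k hk => ?_⟩
    rw [if_neg (by omega)]; exact hN k (by omega)
  · ext ⟨c, d⟩
    simp only [cells, s10_mk, Set.mem_ofPred_eq, Set.mem_insert_iff, Prod.mk.injEq]
    by_cases hc : c = a
    · subst hc; simp only [if_true, true_and]; omega
    · simp only [hc, if_false, false_and, false_or]

theorem s10_addRes_union {ℓ i : ℕ} (hℓ : 2 < ℓ) {lam μ : YPartition} {B : Set (ℕ × ℕ)}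
    (hB : B ⊆ AddableRes ℓ i lam) (hμ : μ.cells = lam.cells ∪ B) :
    AddableRes ℓ i μ = AddableRes ℓ i lam \ B := by
  have key : ∀ p : ℕ × ℕ, res ℓ p ≠ i → (p ∈ μ.cells ↔ p ∈ lam.cells) := by
    intro p hp
    rw [hμ]
    constructor
    · rintro (h | h)
      · exact h
      · exact absurd (hB h).2 hp
    · exact Or.inl
  ext ⟨a, b⟩
  simp only [AddableRes, Set.mem_ofPred_eq, Set.mem_sdiff, s10_addable_iff]
  have e3 : (a, b) ∉ μ.cells ↔ (a, b) ∉ lam.cells ∧ (a, b) ∉ B := by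
    rw [hμ, Set.mem_union]; tauto
  rw [e3]
  by_cases hr : res ℓ (a, b) = i
  · by_cases ha : 1 ≤ a
    · by_cases hb : 1 ≤ b
      · have e1 := key (a - 1, b) (by
          rw [← hr]; apply s10_res_ne hℓ; left; push_cast [Nat.cast_sub ha]; ring)
        have e2 := key (a, b - 1) (by
          rw [← hr]; apply s10_res_ne hℓ; right; push_cast [Nat.cast_sub hb]; ring)
        rw [e1, e2]; tauto
      · tauto
    · tauto
  · tauto

theorem s10_remRes_union {ℓ i : ℕ} (hℓ : 2 < ℓ) {lam μ : YPartition} {B : Set (ℕ × ℕ)}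
    (hB : B ⊆ AddableRes ℓ i lam) (hμ : μ.cells = lam.cells ∪ B) :
    RemovableRes ℓ i μ = RemovableRes ℓ i lam ∪ B := by
  have key : ∀ p : ℕ × ℕ, res ℓ p ≠ i → (p ∈ μ.cells ↔ p ∈ lam.cells) := by
    intro p hp
    rw [hμ]
    constructor
    · rintro (h | h)
      · exact h
      · exact absurd (hB h).2 hp
    · exact Or.inl
  ext ⟨a, b⟩
  simp only [RemovableRes, Set.mem_ofPred_eq, Set.mem_union, s10_removable_iff]
  by_cases hr : res ℓ (a, b) = i
  · have e1 := key (a + 1, b) (by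
      rw [← hr]; apply s10_res_ne hℓ; right; push_cast; ring)
    have e2 := key (a, b + 1) (by
      rw [← hr]; apply s10_res_ne hℓ; left; push_cast; ring)
    rw [e1, e2, hμ, Set.mem_union]
    have : (a, b) ∈ B → (a + 1, b) ∉ lam.cells ∧ (a, b + 1) ∉ lam.cells := by
      intro h
      have h1 := (hB h).1
      simp only [Addable] at h1
      simp only [cells, Set.mem_ofPred_eq]
      have h2 := lam.antitone a (a + 1) h1.1 (by omega)
      omega
    tauto
  · have : (a, b) ∉ B := fun h => hr (hB h).2
    tauto

/-- common form of the crystal operators -/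
def s10_F (le : ℕ × ℕ → ℕ × ℕ → Prop) (ℓ i : ℕ) (lam mu : YPartition) : Prop :=
  ∃ p, (ConormalIn le (RemovableRes ℓ i lam) (AddableRes ℓ i lam) p ∧
    ∀ q, ConormalIn le (RemovableRes ℓ i lam) (AddableRes ℓ i lam) q → le q p) ∧
    mu.cells = insert p lam.cells

theorem s10_add_finite (ℓ i : ℕ) (μ : YPartition) : (AddableRes ℓ i μ).Finite := by
  obtain ⟨N, hN⟩ := μ.eventually_zero
  apply ((Set.finite_Iic (N + 1)).prod (Set.finite_Iic (μ.part 1 + 1))).subset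
  rintro ⟨a, b⟩ ⟨⟨h1, h2, h3⟩, -⟩
  simp only [Set.mem_prod, Set.mem_Iic] at *
  constructor
  · by_contra hc
    have := hN (a - 1) (by omega)
    omega
  · have := μ.antitone 1 a le_rfl h1
    omega

theorem s10_conormal_iff {le : ℕ × ℕ → ℕ × ℕ → Prop} (hrefl : ∀ p, le p p)
    {A B : Set (ℕ × ℕ)} (hA : A.Finite) (hB : B ⊆ A)
    (hup : ∀ b ∈ B, ∀ p ∈ A, le b p → p ∈ B) (q : ℕ × ℕ) :
    ConormalIn le B (A \ B) q ↔ q ∈ A \ B := by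
  constructor
  · exact fun h => h.1
  · intro hq
    refine ⟨hq, fun p hp hpq => ?_⟩
    have h1 : B ∩ {s | le p s ∧ le s q} = ∅ := by
      ext s
      simp only [Set.mem_inter_iff, Set.mem_ofPred_eq, Set.mem_empty_iff_false, iff_false]
      rintro ⟨hs, -, hsq⟩
      exact hq.2 (hup s hs q hq.1 hsq)
    rw [h1, Set.ncard_empty]
    rw [Set.ncard_pos ((hA.subset Set.sdiff_subset).subset Set.inter_subset_left)]
    exact ⟨q, hq, hpq, hrefl q⟩

theorem s10_exists_max {le : ℕ × ℕ → ℕ × ℕ → Prop} (htot : ∀ p q, le p q ∨ le q p)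
    (htr : ∀ p q r, le p q → le q r → le p r) {s : Set (ℕ × ℕ)} (hs : s.Finite)
    (hne : s.Nonempty) : ∃ p ∈ s, ∀ q ∈ s, le q p := by
  induction s, hs using Set.Finite.induction_on with
  | empty => exact absurd hne Set.not_nonempty_empty
  | @insert a s ha hs ih =>
    rcases s.eq_empty_or_nonempty with rfl | h
    · refine ⟨a, by simp, fun q hq => ?_⟩
      simp at hq; subst hq; exact (htot q q).elim id id
    · obtain ⟨p, hp, hm⟩ := ih h
      rcases htot a p with h1 | h1
      · refine ⟨p, Or.inr hp, ?_⟩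
        rintro q (rfl | hq)
        · exact h1
        · exact hm q hq
      · refine ⟨a, Or.inl rfl, ?_⟩
        rintro q (rfl | hq)
        · exact (htot q q).elim id id
        · exact htr _ _ _ (hm q hq) h1

theorem s10_iter {le : ℕ × ℕ → ℕ × ℕ → Prop} (htot : ∀ p q, le p q ∨ le q p)
    (htr : ∀ p q r, le p q → le q r → le p r) {ℓ i : ℕ} (hℓ : 2 < ℓ) {lam : YPartition}
    (hanti : ∀ p ∈ AddableRes ℓ i lam, ∀ q ∈ AddableRes ℓ i lam, le p q → le q p → p = q)
    (hrem : RemovableRes ℓ i lam = ∅) (n : ℕ) :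
    ∀ (B : Set (ℕ × ℕ)) (μ : YPartition), B ⊆ AddableRes ℓ i lam →
      (∀ b ∈ B, ∀ p ∈ AddableRes ℓ i lam, le b p → p ∈ B) →
      μ.cells = lam.cells ∪ B → (AddableRes ℓ i lam \ B).ncard = n →
      ∀ τ, RelIter (s10_F le ℓ i) n μ τ ↔ τ.cells = lam.cells ∪ AddableRes ℓ i lam := by
  have hA := s10_add_finite ℓ i lam
  have hrefl : ∀ p, le p p := fun p => (htot p p).elim id id
  induction n with
  | zero =>
    intro B μ hB hup hμ hn τ
    rw [Set.ncard_eq_zero (hA.subset Set.sdiff_subset)] at hn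
    have hBA : B = AddableRes ℓ i lam := hB.antisymm (Set.sdiff_eq_empty.mp hn)
    simp only [RelIter]
    constructor
    · rintro rfl; rw [hμ, hBA]
    · intro h; apply s10_cells_inj; rw [h, hμ, hBA]
  | succ n ih =>
    intro B μ hB hup hμ hn τ
    have hR := s10_remRes_union hℓ hB hμ
    rw [hrem, Set.empty_union] at hR
    have hAd := s10_addRes_union hℓ hB hμ
    have hcon : ∀ q, ConormalIn le (RemovableRes ℓ i μ) (AddableRes ℓ i μ) q ↔
        q ∈ AddableRes ℓ i lam \ B := by
      intro q; rw [hR, hAd]; exact s10_conormal_iff hrefl hA hB hup q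
    have step : ∀ p ∈ AddableRes ℓ i lam \ B, (∀ q ∈ AddableRes ℓ i lam \ B, le q p) →
        ∀ c : YPartition, c.cells = insert p μ.cells →
        (RelIter (s10_F le ℓ i) n c τ ↔ τ.cells = lam.cells ∪ AddableRes ℓ i lam) := by
      intro p hp hmax c hc
      apply ih (insert p B) c
      · exact Set.insert_subset hp.1 hB
      · rintro b (rfl | hb) q hq hbq
        · by_cases hqB : q ∈ B
          · exact Or.inr hqB
          · exact Or.inl (hanti q hq b hp.1 (hmax q ⟨hq, hqB⟩) hbq)
        · exact Or.inr (hup b hb q hq hbq)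
      · rw [hc, hμ, Set.union_insert]
      · have h1 : AddableRes ℓ i lam \ insert p B = (AddableRes ℓ i lam \ B) \ {p} := by
          ext x; simp only [Set.mem_sdiff, Set.mem_insert_iff, Set.mem_singleton_iff]; tauto
        rw [h1, Set.ncard_sdiff_singleton_of_mem hp, hn]; rfl
    simp only [RelIter]
    constructor
    · rintro ⟨c, ⟨p, ⟨hp, hmax⟩, hc⟩, hcτ⟩
      rw [hcon] at hp
      exact (step p hp (fun q hq => hmax q ((hcon q).2 hq)) c hc).1 hcτ
    · intro hτ
      have hne : (AddableRes ℓ i lam \ B).Nonempty := by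
        rw [← Set.ncard_pos (hA.subset Set.sdiff_subset)]; omega
      obtain ⟨p, hp, hmax⟩ := s10_exists_max htot htr (hA.subset Set.sdiff_subset) hne
      have hpμ : p ∈ AddableRes ℓ i μ := by rw [hAd]; exact hp
      obtain ⟨c, hc⟩ := s10_exists_insert μ p hpμ.1
      exact ⟨c, ⟨p, ⟨(hcon p).2 hp, fun q hq => hmax q ((hcon q).1 hq)⟩, hc⟩,
        (step p hp hmax c hc).2 hτ⟩

theorem s10_phi_gen {le : ℕ × ℕ → ℕ × ℕ → Prop} (hrefl : ∀ p, le p p) {ℓ i : ℕ}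
    {lam : YPartition} (hrem : RemovableRes ℓ i lam = ∅) :
    {p | ConormalIn le (RemovableRes ℓ i lam) (AddableRes ℓ i lam) p}.ncard =
      (AddableRes ℓ i lam).ncard := by
  congr 1
  ext q
  have := s10_conormal_iff hrefl (s10_add_finite ℓ i lam) (Set.empty_subset _)
    (by simp) q
  rw [Set.sdiff_empty] at this
  rw [hrem]; exact this

theorem s10_phi_zero {le : ℕ × ℕ → ℕ × ℕ → Prop} {ℓ i : ℕ}
    {lam : YPartition} (hadd : AddableRes ℓ i lam = ∅) :
    {p | ConormalIn le (RemovableRes ℓ i lam) (AddableRes ℓ i lam) p}.ncard = 0 := by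
  have : {p | ConormalIn le (RemovableRes ℓ i lam) (AddableRes ℓ i lam) p} = ∅ := by
    ext q
    simp only [Set.mem_ofPred_eq, Set.mem_empty_iff_false, iff_false]
    intro h
    have := h.1
    rw [hadd] at this
    exact this
  rw [this, Set.ncard_empty]

theorem s10_ladder_total (ℓ : ℕ) (p q : ℕ × ℕ) : LadderLE ℓ p q ∨ LadderLE ℓ q p := by
  unfold LadderLE; omega

theorem s10_ladder_trans (ℓ : ℕ) (p q r : ℕ × ℕ) :
    LadderLE ℓ p q → LadderLE ℓ q r → LadderLE ℓ p r := by
  unfold LadderLE; omega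

theorem s10_ladder_anti {ℓ : ℕ} (hℓ : 2 < ℓ) {p q : ℕ × ℕ} (hp : 1 ≤ p.2) (hq : 1 ≤ q.2) :
    LadderLE ℓ p q → LadderLE ℓ q p → p = q := by
  unfold LadderLE
  intro h1 h2
  have h3 : p.1 = q.1 := by omega
  have h4 : ladderIdx ℓ p = ladderIdx ℓ q := by omega
  unfold ladderIdx at h4
  have h5 : (ℓ - 1) * (p.2 - 1) = (ℓ - 1) * (q.2 - 1) := by omega
  have h6 := Nat.eq_of_mul_eq_mul_left (by omega : 0 < ℓ - 1) h5
  exact Prod.ext h3 (by omega)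

theorem s10_hat_iter {ℓ i : ℕ} (hℓ : 2 < ℓ) {lam : YPartition}
    (hrem : RemovableRes ℓ i lam = ∅) (τ : YPartition) :
    RelIter (HatF ℓ i) (AddableRes ℓ i lam).ncard lam τ ↔
      τ.cells = lam.cells ∪ AddableRes ℓ i lam := by
  refine s10_iter (s10_ladder_total ℓ) (s10_ladder_trans ℓ) hℓ ?_ hrem _ ∅ lam
    (Set.empty_subset _) (by simp) (by simp) (by simp) τ
  rintro p ⟨hp, -⟩ q ⟨hq, -⟩
  exact s10_ladder_anti hℓ (by rw [hp.2.1]; omega) (by rw [hq.2.1]; omega)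

theorem s10_tilde_iter {ℓ i : ℕ} (hℓ : 2 < ℓ) {lam : YPartition}
    (hrem : RemovableRes ℓ i lam = ∅) (τ : YPartition) :
    RelIter (TildeF ℓ i) (AddableRes ℓ i lam).ncard lam τ ↔
      τ.cells = lam.cells ∪ AddableRes ℓ i lam := by
  refine s10_iter (le := RowLE) ?_ ?_ hℓ ?_ hrem _ ∅ lam
    (Set.empty_subset _) (by simp) (by simp) (by simp) τ
  · intro p q; unfold RowLE; omega
  · intro p q r; unfold RowLE; omega
  · rintro p ⟨hp, -⟩ q ⟨hq, -⟩ h1 h2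
    unfold RowLE at h1 h2
    have h3 : p.1 = q.1 := by omega
    exact Prod.ext h3 (by rw [hp.2.1, hq.2.1, h3])

/-- the beta set is closed under subtracting `ℓ` -/
def s10_Closed (ℓ : ℕ) (μ : YPartition) : Prop :=
  ∀ a, 1 ≤ a → ∃ b, 1 ≤ b ∧ (μ.part b : ℤ) - b = (μ.part a : ℤ) - a - ℓ

theorem s10_closed_mul {ℓ : ℕ} {μ : YPartition} (h : s10_Closed ℓ μ) (k : ℕ) :
    ∀ a, 1 ≤ a → ∃ b, 1 ≤ b ∧ (μ.part b : ℤ) - b = (μ.part a : ℤ) - a - ℓ * k := by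
  induction k with
  | zero => intro a ha; exact ⟨a, ha, by simp⟩
  | succ k ih =>
    intro a ha
    obtain ⟨b, hb, e⟩ := ih a ha
    obtain ⟨c, hc, e'⟩ := h b hb
    refine ⟨c, hc, ?_⟩
    push_cast
    linarith

/-- an addable box gives a gap in the beta set -/
theorem s10_add_gap {μ : YPartition} {p : ℕ × ℕ} (hp : Addable μ p) (b : ℕ) (hb : 1 ≤ b) :
    (μ.part b : ℤ) - b ≠ (p.2 : ℤ) - p.1 := by
  obtain ⟨h1, h2, h3⟩ := hp
  intro he
  rcases lt_or_ge b p.1 with h | h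
  · have h4 := μ.antitone b (p.1 - 1) hb (by omega)
    omega
  · have h4 := μ.antitone p.1 b h1 h
    omega

theorem s10_rem_gap {μ : YPartition} {p : ℕ × ℕ} (hp : Removable μ p) (b : ℕ) (hb : 1 ≤ b) :
    (μ.part b : ℤ) - b ≠ (p.2 : ℤ) - p.1 - 1 := by
  obtain ⟨h1, h2, h3⟩ := hp
  intro he
  rcases lt_or_ge p.1 b with h | h
  · have h4 := μ.antitone (p.1 + 1) b (by omega) (by omega)
    omega
  · have h4 := μ.antitone b p.1 hb h
    omega

theorem s10_no_mix {ℓ i : ℕ} (hℓ : 2 < ℓ) {μ : YPartition} (h : s10_Closed ℓ μ)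
    {p q : ℕ × ℕ} (hp : p ∈ AddableRes ℓ i μ) (hq : q ∈ RemovableRes ℓ i μ) : False := by
  obtain ⟨k, hk⟩ := s10_res_eq hℓ (hp.2.trans hq.2.symm)
  have hpa := hp.1.2.1
  have hqa := hq.1.2.1
  rcases le_or_gt k 0 with hk0 | hk0
  · obtain ⟨b, hb, e⟩ := s10_closed_mul h (-k).toNat q.1 hq.1.1
    apply s10_add_gap hp.1 b hb
    rw [Int.toNat_of_nonneg (by omega), mul_neg] at e
    omega
  · obtain ⟨b, hb, e⟩ := s10_closed_mul h k.toNat p.1 hp.1.1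
    apply s10_rem_gap hq.1 b hb
    rw [Int.toNat_of_nonneg (by omega)] at e
    omega

/-- remove all removable `i`-boxes -/
theorem s10_exists_strip {ℓ : ℕ} (hℓ : 2 < ℓ) (i : ℕ) {lam : YPartition}
    (h : s10_Closed ℓ lam) :
    ∃ μ : YPartition, s10_Closed ℓ μ ∧ μ.cells = lam.cells \ RemovableRes ℓ i lam := by
  classical
  have hR : ∀ a, (a, lam.part a) ∈ RemovableRes ℓ i lam ↔
      1 ≤ a ∧ lam.part (a + 1) < lam.part a ∧ res ℓ (a, lam.part a) = i := by
    intro a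
    simp only [RemovableRes, Removable, Set.mem_ofPred_eq]; tauto
  refine ⟨s10_mk (fun a => if (a, lam.part a) ∈ RemovableRes ℓ i lam then lam.part a - 1
    else lam.part a) ?_ ?_ ?_, ?_, ?_⟩
  · rw [lam.zero_at_zero]; simp
  · intro a ha
    have h1 := lam.antitone a (a + 1) ha (by omega)
    have h2 := hR a
    split_ifs with g1 g2 g2 <;> first | omega | (have := h2.1 g2; omega)
  · obtain ⟨N, hN⟩ := lam.eventually_zero
    refine ⟨N, fun k hk => ?_⟩
    have := hN k hk
    split_ifs <;> omega
  · intro a ha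
    simp only [s10_mk]
    obtain ⟨b, hb, e⟩ := h a ha
    by_cases ga : (a, lam.part a) ∈ RemovableRes ℓ i lam
    · have ga' := (hR a).1 ga
      by_cases gb : (b, lam.part b) ∈ RemovableRes ℓ i lam
      · have gb' := (hR b).1 gb
        refine ⟨b, hb, ?_⟩
        rw [if_pos ga, if_pos gb]
        omega
      · have hres : res ℓ (b, lam.part b) = i := by
          rw [← ga'.2.2]; apply s10_res_of (-1); simp only; linarith
        have hnr : lam.part b ≤ lam.part (b + 1) := by
          by_contra hc
          exact gb ((hR b).2 ⟨hb, by omega, hres⟩)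
        have h2 := lam.antitone b (b + 1) hb (by omega)
        have heq : lam.part (b + 1) = lam.part b := by omega
        refine ⟨b + 1, by omega, ?_⟩
        have gc : (b + 1, lam.part (b + 1)) ∉ RemovableRes ℓ i lam := by
          intro gc
          have h3 := ((hR _).1 gc).2.2
          refine s10_res_ne hℓ ?_ (h3.trans hres.symm)
          right
          simp only [heq]; push_cast; ring
        rw [if_pos ga, if_neg gc]
        omega
    · by_cases gb : (b, lam.part b) ∈ RemovableRes ℓ i lam
      · exfalso
        have gb' := (hR b).1 gb
        have hres : res ℓ (a, lam.part a) = i := by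
          rw [← gb'.2.2]; apply s10_res_of 1; simp only; linarith
        have hnr : lam.part a ≤ lam.part (a + 1) := by
          by_contra hc
          exact ga ((hR a).2 ⟨ha, by omega, hres⟩)
        have h2 := lam.antitone a (a + 1) ha (by omega)
        obtain ⟨c, hc, e'⟩ := h (a + 1) (by omega)
        apply s10_rem_gap gb.1 c hc
        simp only
        omega
      · refine ⟨b, hb, ?_⟩
        rw [if_neg ga, if_neg gb]
        exact e
  · ext ⟨a, b⟩
    simp only [cells, s10_mk, Set.mem_ofPred_eq, Set.mem_sdiff]
    by_cases ga : (a, lam.part a) ∈ RemovableRes ℓ i lam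
    · rw [if_pos ga]
      constructor
      · rintro ⟨h1, h2, h3⟩
        refine ⟨⟨h1, h2, by omega⟩, fun hc => ?_⟩
        have := hc.1.2.1
        simp only at this
        omega
      · rintro ⟨⟨h1, h2, h3⟩, h4⟩
        refine ⟨h1, h2, ?_⟩
        have : b ≠ lam.part a := by rintro rfl; exact h4 ga
        omega
    · rw [if_neg ga]
      constructor
      · rintro ⟨h1, h2, h3⟩
        refine ⟨⟨h1, h2, by omega⟩, fun hc => ?_⟩
        have h5 := hc.1.2.1
        simp only at h5
        subst h5
        exact ga hc
      · exact fun h => h.1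

theorem s10_strip_sets {ℓ i : ℕ} (hℓ : 2 < ℓ) {lam μ : YPartition}
    (hadd : AddableRes ℓ i lam = ∅) (hμ : μ.cells = lam.cells \ RemovableRes ℓ i lam) :
    RemovableRes ℓ i μ = ∅ ∧ AddableRes ℓ i μ = RemovableRes ℓ i lam := by
  have key : ∀ p : ℕ × ℕ, res ℓ p ≠ i → (p ∈ μ.cells ↔ p ∈ lam.cells) := by
    intro p hp
    rw [hμ]
    constructor
    · exact fun h => h.1
    · exact fun h => ⟨h, fun hc => hp hc.2⟩
  constructor
  · ext ⟨a, b⟩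
    simp only [Set.mem_empty_iff_false, iff_false]
    rintro ⟨h1, hr⟩
    rw [s10_removable_iff] at h1
    have e1 := key (a + 1, b) (by
      rw [← hr]; apply s10_res_ne hℓ; right; push_cast; ring)
    have e2 := key (a, b + 1) (by
      rw [← hr]; apply s10_res_ne hℓ; left; push_cast; ring)
    rw [e1, e2, hμ] at h1
    exact h1.1.2 ⟨(s10_removable_iff _ _ _).2 ⟨h1.1.1, h1.2⟩, hr⟩
  · ext ⟨a, b⟩
    by_cases hr : res ℓ (a, b) = i
    · by_cases ha : 1 ≤ a ∧ 1 ≤ b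
      · have e1 := key (a - 1, b) (by
          rw [← hr]; apply s10_res_ne hℓ; left; push_cast [Nat.cast_sub ha.1]; ring)
        have e2 := key (a, b - 1) (by
          rw [← hr]; apply s10_res_ne hℓ; right; push_cast [Nat.cast_sub ha.2]; ring)
        constructor
        · rintro ⟨h1, -⟩
          rw [s10_addable_iff, e1, e2] at h1
          by_contra hc
          have hnl : (a, b) ∉ lam.cells := by
            intro hl
            apply h1.2.2.1
            rw [hμ]; exact ⟨hl, hc⟩
          have : (a, b) ∈ AddableRes ℓ i lam :=
            ⟨(s10_addable_iff _ _ _).2 ⟨h1.1, h1.2.1, hnl, h1.2.2.2⟩, hr⟩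
          rw [hadd] at this
          exact this
        · intro h1
          refine ⟨?_, hr⟩
          rw [s10_addable_iff, e1, e2]
          refine ⟨ha.1, ha.2, ?_, ?_⟩
          · rw [hμ]; exact fun hc => hc.2 h1
          · have h2 := h1.1
            simp only [Removable] at h2
            simp only [cells, Set.mem_ofPred_eq]
            have h3 : a = 1 ∨ lam.part a ≤ lam.part (a - 1) := by
              rcases Nat.eq_or_lt_of_le ha.1 with h | h
              · left; omega
              · right; exact lam.antitone (a - 1) a (by omega) (by omega)
            omega
      · constructor
        · rintro ⟨h1, -⟩
          rw [s10_addable_iff] at h1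
          exact absurd ⟨h1.1, h1.2.1⟩ ha
        · rintro ⟨h1, -⟩
          simp only [Removable] at h1
          exact absurd ⟨h1.1, by omega⟩ ha
    · constructor
      · exact fun h => absurd h.2 hr
      · exact fun h => absurd h.2 hr

theorem s10_reach_of_iter {ℓ i : ℕ} (hi : i < ℓ) (n : ℕ) :
    ∀ μ τ : YPartition, RelIter (HatF ℓ i) n μ τ →
      Relation.ReflTransGen (fun a b => ∃ i : ℕ, i < ℓ ∧ HatF ℓ i a b) μ τ := by
  induction n with
  | zero => intro μ τ h; simp only [RelIter] at h; subst h; exact .refl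
  | succ n ih =>
    rintro μ τ ⟨c, h1, h2⟩
    exact .head ⟨i, hi, h1⟩ (ih c τ h2)

theorem s10_node {ℓ : ℕ} (hℓ : 2 < ℓ) (n : ℕ) :
    ∀ lam : YPartition, s10_Closed ℓ lam → lam.cells.ncard = n → LadderNode ℓ lam := by
  induction n using Nat.strong_induction_on with
  | _ n ih =>
    intro lam hcl hn
    rcases lam.cells.eq_empty_or_nonempty with he | hne
    · have : lam = emptyP := by
        apply s10_cells_inj
        rw [he]
        ext ⟨a, b⟩
        simp only [cells, emptyP, Set.mem_ofPred_eq, Set.mem_empty_iff_false, false_iff]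
        omega
      subst this
      exact .refl
    · obtain ⟨⟨a, b⟩, hp, hmax⟩ := Set.exists_max_image lam.cells
        (fun p => p.1 + p.2) (s10_cells_finite lam) hne
      have hrem : Removable lam (a, b) := by
        rw [s10_removable_iff]
        refine ⟨hp, fun hc => ?_, fun hc => ?_⟩
        · have := hmax _ hc; simp only at this; omega
        · have := hmax _ hc; simp only at this; omega
      have hmem : (a, b) ∈ RemovableRes ℓ (res ℓ (a, b)) lam := ⟨hrem, rfl⟩
      set i := res ℓ (a, b) with hi
      have hadd : AddableRes ℓ i lam = ∅ := by
        ext q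
        simp only [Set.mem_empty_iff_false, iff_false]
        exact fun hq => s10_no_mix hℓ hcl hq hmem
      obtain ⟨μ, hμc, hμ⟩ := s10_exists_strip hℓ i hcl
      obtain ⟨h1, h2⟩ := s10_strip_sets hℓ hadd hμ
      have hsub : RemovableRes ℓ i lam ⊆ lam.cells := by
        rintro ⟨c, d⟩ ⟨hq, -⟩
        exact ((s10_removable_iff _ _ _).1 hq).1
      have hlt : μ.cells.ncard < n := by
        rw [← hn]
        apply Set.ncard_lt_ncard _ (s10_cells_finite lam)
        rw [hμ]
        exact ⟨Set.sdiff_subset, fun hc => (hc hp).2 hmem⟩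
      have hnode := ih _ hlt μ hμc rfl
      have hit := (s10_hat_iter hℓ h1 lam).2 (by
        rw [h2, hμ, Set.sdiff_union_of_subset hsub])
      exact Relation.ReflTransGen.trans hnode (s10_reach_of_iter (s10_res_lt hℓ _) _ _ _ hit)

/-- a core has closed beta set -/
theorem s10_core_closed {ℓ : ℕ} (hℓ : 2 < ℓ) {lam : YPartition} (hcore : IsCore ℓ lam) :
    s10_Closed ℓ lam := by
  by_contra hcl
  unfold s10_Closed at hcl
  push Not at hcl
  obtain ⟨a, ha, hgap⟩ := hcl
  apply hcore
  set y : ℤ := (lam.part a : ℤ) - a - ℓ with hy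
  obtain ⟨N, hN⟩ := lam.eventually_zero
  -- row search
  have search : ∀ z : ℤ, z ≤ (lam.part a : ℤ) - a →
      ∃ c, a ≤ c ∧ z ≤ (lam.part c : ℤ) - c ∧ (lam.part (c + 1) : ℤ) - (c + 1 : ℕ) < z := by
    intro z hz
    by_contra hcon
    push Not at hcon
    have hall : ∀ c, a ≤ c → z ≤ (lam.part c : ℤ) - c := by
      intro c hc
      induction c, hc using Nat.le_induction with
      | base => exact hz
      | succ c hc ih => exact hcon c hc ih
    have h1 := hall (a + N + z.natAbs + 1) (by omega)
    rw [hN _ (by omega)] at h1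
    omega
  obtain ⟨c, hac, hc1, hc2⟩ := search y (by omega)
  have hc1' : y < (lam.part c : ℤ) - c := lt_of_le_of_ne hc1 (hgap c (by omega)).symm
  have hdec : ∀ j k, 1 ≤ j → j ≤ k → lam.part k ≤ lam.part j := lam.antitone
  have hyc : 0 ≤ y + c := by omega
  let f : ℕ → ℕ := fun k => if k < a then lam.part k else if k < c then lam.part (k + 1) - 1
    else if k = c then (y + c).toNat else lam.part k
  have f1 : ∀ k, k < a → f k = lam.part k := fun k hk => by simp only [f]; rw [if_pos hk]
  have f2 : ∀ k, a ≤ k → k < c → f k = lam.part (k + 1) - 1 := fun k h1 h2 => by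
    simp only [f]; rw [if_neg (by omega), if_pos h2]
  have f3 : (f c : ℤ) = y + c := by
    simp only [f]; rw [if_neg (by omega), if_neg (by omega), if_true]; omega
  have f4 : ∀ k, c < k → f k = lam.part k := fun k h1 => by
    simp only [f]; rw [if_neg (by omega), if_neg (by omega), if_neg (by omega)]
  clear_value f
  have hpos : ∀ k, 1 ≤ k → k ≤ c → lam.part c ≤ lam.part k ∧ 1 ≤ lam.part k := by
    intro k h1 h2
    have := hdec k c h1 h2
    omega
  let ν : YPartition := s10_mk f (by rw [f1 0 (by omega)]; exact lam.zero_at_zero) (by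
    intro k hk
    have hk1 := hdec k (k + 1) hk (by omega)
    have hk2 := hdec (k + 1) (k + 2) (by omega) (by omega)
    rcases lt_or_ge k a with h | h
    · rw [f1 k h]
      rcases lt_or_ge (k + 1) a with h' | h'
      · rw [f1 _ h']; exact hk1
      · rcases lt_or_ge (k + 1) c with h'' | h''
        · rw [f2 _ h' h'']
          have : k + 1 + 1 = k + 2 := rfl
          rw [this]; omega
        · have : k + 1 = c := by omega
          rw [this] at hk1 ⊢
          omega
    · rcases lt_or_ge k c with h' | h'
      · rw [f2 k h h']
        rcases lt_or_ge (k + 1) c with h'' | h''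
        · rw [f2 _ (by omega) h'']
          have : k + 1 + 1 = k + 2 := rfl
          rw [this]; omega
        · have : k + 1 = c := by omega
          rw [this] at hk1 ⊢
          omega
      · rw [f4 (k + 1) (by omega)]
        rcases Nat.eq_or_lt_of_le h' with h'' | h''
        · subst h''; push_cast at hc2; omega
        · rw [f4 k h'']; exact hk1) ⟨N + c + 1, fun k hk => by
            rw [f4 k (by omega)]; exact hN k (by omega)⟩
  have hνcells : ∀ k b, (k, b) ∈ ν.cells ↔ 1 ≤ k ∧ 1 ≤ b ∧ b ≤ f k := fun k b => Iff.rfl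
  have hf_le : ∀ k, 1 ≤ k → f k ≤ lam.part k := by
    intro k hk
    have hk1 := hdec k (k + 1) hk (by omega)
    rcases lt_or_ge k a with h | h
    · rw [f1 k h]
    · rcases lt_trichotomy k c with h' | h' | h'
      · rw [f2 k h h']; omega
      · subst h'; omega
      · rw [f4 k h']
  have hSmem : ∀ k b, (k, b) ∈ lam.cells \ ν.cells ↔
      a ≤ k ∧ k ≤ c ∧ f k < b ∧ b ≤ lam.part k := by
    intro k b
    rw [Set.mem_sdiff, hνcells]
    simp only [cells, Set.mem_ofPred_eq]
    constructor
    · rintro ⟨⟨h1, h2, h3⟩, h4⟩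
      refine ⟨?_, ?_, by omega, h3⟩
      · by_contra hc
        have := f1 k (by omega)
        omega
      · by_contra hc
        have := f4 k (by omega)
        omega
    · rintro ⟨h1, h2, h3, h4⟩
      omega
  -- lower bound in non-last rows
  have hlow : ∀ k b, a ≤ k → k < c → (f k < b ↔ lam.part (k + 1) ≤ b) := by
    intro k b h1 h2
    have := (hpos (k + 1) (by omega) (by omega)).2
    rw [f2 k h1 h2]; omega
  refine ⟨lam.cells \ ν.cells, Set.sdiff_subset, ?_, ?_, ?_, ν, ?_⟩
  · -- cardinality
    have himg : (fun p : ℕ × ℕ => (p.2 : ℤ) - p.1) '' (lam.cells \ ν.cells) =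
        Set.Ioc y (y + ℓ) := by
      ext z
      simp only [Set.mem_image, Set.mem_Ioc, Prod.exists]
      constructor
      · rintro ⟨k, b, hS, rfl⟩
        obtain ⟨h1, h2, h3, h4⟩ := (hSmem k b).1 hS
        have h5 := hdec a k ha h1
        refine ⟨?_, by omega⟩
        rcases Nat.eq_or_lt_of_le h2 with h | h
        · subst h; omega
        · have h6 := (hlow k b h1 h).1 h3
          have h7 := hdec (k + 1) c (by omega) (by omega)
          omega
      · rintro ⟨h1, h2⟩
        obtain ⟨k, hk1, hk2, hk3⟩ := search z (by omega)
        have hkc : k ≤ c := by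
          by_contra hc
          have := hdec (c + 1) k (by omega) (by omega)
          push_cast at hc2
          omega
        refine ⟨k, (z + k).toNat, (hSmem _ _).2 ⟨hk1, hkc, ?_, by omega⟩, by omega⟩
        rcases Nat.eq_or_lt_of_le hkc with h | h
        · subst h; omega
        · rw [hlow k _ hk1 h]
          push_cast at hk3
          omega
    have hinj : Set.InjOn (fun p : ℕ × ℕ => (p.2 : ℤ) - p.1) (lam.cells \ ν.cells) := by
      have aux : ∀ k b k' b', (k, b) ∈ lam.cells \ ν.cells → (k', b') ∈ lam.cells \ ν.cells →
          (b : ℤ) - k = (b' : ℤ) - k' → ¬ k < k' := by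
        intro k b k' b' h1' h2' he hlt
        obtain ⟨h1, h2, h3, h4⟩ := (hSmem k b).1 h1'
        obtain ⟨g1, g2, g3, g4⟩ := (hSmem k' b').1 h2'
        have h6 := (hlow k b h1 (by omega)).1 h3
        have h7 := hdec (k + 1) k' (by omega) (by omega)
        omega
      rintro ⟨k, b⟩ h1 ⟨k', b'⟩ h2 he
      simp only at he
      have e1 := aux _ _ _ _ h1 h2 he
      have e2 := aux _ _ _ _ h2 h1 he.symm
      ext <;> simp only <;> omega
    rw [← Set.ncard_image_of_injOn hinj, himg, ← Finset.coe_Ioc, Set.ncard_coe_finset]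
    simp
  · -- connectedness
    set S := lam.cells \ ν.cells with hS
    have hsymm : ∀ p q, Relation.ReflTransGen (fun x y => x ∈ S ∧ y ∈ S ∧ BoxAdjacent x y) p q →
        Relation.ReflTransGen (fun x y => x ∈ S ∧ y ∈ S ∧ BoxAdjacent x y) q p := by
      intro p q h
      induction h with
      | refl => exact .refl
      | tail _ h ih =>
        refine .head ⟨h.2.1, h.1, ?_⟩ ih
        have := h.2.2
        unfold BoxAdjacent at this ⊢
        omega
    have hto : ∀ n : ℕ, ∀ k b, (k, b) ∈ S → (k - a) + (lam.part a - b) = n →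
        Relation.ReflTransGen (fun x y => x ∈ S ∧ y ∈ S ∧ BoxAdjacent x y) (k, b)
          (a, lam.part a) := by
      intro n
      induction n with
      | zero =>
        intro k b hkb hn
        obtain ⟨h1, h2, h3, h4⟩ := (hSmem k b).1 hkb
        have h5 := hdec a k ha h1
        have e1 : k = a := by omega
        have e2 : b = lam.part a := by omega
        rw [e1, e2]
      | succ n ih =>
        intro k b hkb hn
        obtain ⟨h1, h2, h3, h4⟩ := (hSmem k b).1 hkb
        have h5 := hdec a k ha h1
        rcases Nat.eq_or_lt_of_le h4 with h | h
        · have hka : a < k := by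
            by_contra hc
            have : k = a := by omega
            subst this
            omega
          have h6 := hdec (k - 1) k (by omega) (by omega)
          have hmem : (k - 1, b) ∈ S := by
            rw [hSmem]
            refine ⟨by omega, by omega, ?_, by omega⟩
            rw [hlow _ _ (by omega) (by omega)]
            have : k - 1 + 1 = k := by omega
            rw [this]; omega
          refine .head ⟨hkb, hmem, ?_⟩ (ih _ _ hmem (by omega))
          exact Or.inr ⟨rfl, Or.inr (by simp only; omega)⟩
        · have hmem : (k, b + 1) ∈ S := by
            rw [hSmem]; omega
          refine .head ⟨hkb, hmem, ?_⟩ (ih _ _ hmem (by omega))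
          exact Or.inl ⟨rfl, Or.inl rfl⟩
    rintro ⟨k, b⟩ h1 ⟨k', b'⟩ h2
    exact (hto _ k b h1 rfl).trans (hsymm _ _ (hto _ k' b' h2 rfl))
  · rintro ⟨k, b, h1, -, -, h4⟩
    obtain ⟨g1, g2, g3, g4⟩ := (hSmem _ _).1 h1
    obtain ⟨j1, j2, j3, j4⟩ := (hSmem _ _).1 h4
    have := (hlow k b g1 (by omega)).1 g3
    omega
  · ext ⟨k, b⟩
    simp only [Set.mem_sdiff, hνcells]
    simp only [cells, Set.mem_ofPred_eq]
    constructor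
    · rintro ⟨h1, h2, h3⟩
      have := hf_le k h1
      refine ⟨⟨h1, h2, by omega⟩, fun hc => hc.2 ⟨h1, h2, h3⟩⟩
    · rintro ⟨h1, h2⟩
      by_contra hc
      exact h2 ⟨h1, hc⟩

/-- for an `ℓ`-core `λ`, `φ̂_i(λ) = φ_i(λ)` and
`f̂_i^{φ̂_i(λ)} λ = f̃_i^{φ_i(λ)} λ`; consequently every `ℓ`-core is a node of `B(Λ₀)^L`. -/
theorem statement10 (ℓ : ℕ) (hℓ : 2 < ℓ) (i : ℕ) (hi : i < ℓ) (lam : YPartition)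
    (hcore : IsCore ℓ lam) :
    hatPhi ℓ i lam = phi ℓ i lam ∧
    (∀ mu : YPartition,
      RelIter (HatF ℓ i) (hatPhi ℓ i lam) lam mu ↔
      RelIter (TildeF ℓ i) (phi ℓ i lam) lam mu) ∧
    LadderNode ℓ lam := by
  have hcl := s10_core_closed hℓ hcore
  refine ⟨?_, ?_, s10_node hℓ _ lam hcl rfl⟩
  · rcases (RemovableRes ℓ i lam).eq_empty_or_nonempty with hrem | ⟨q, hq⟩
    · exact (s10_phi_gen (fun p => (s10_ladder_total ℓ p p).elim id id) hrem).trans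
        (s10_phi_gen (le := RowLE) (fun p => le_refl _) hrem).symm
    · have hadd : AddableRes ℓ i lam = ∅ := by
        ext p
        simp only [Set.mem_empty_iff_false, iff_false]
        exact fun hp => s10_no_mix hℓ hcl hp hq
      exact (s10_phi_zero hadd).trans (s10_phi_zero (le := RowLE) hadd).symm
  · intro mu
    rcases (RemovableRes ℓ i lam).eq_empty_or_nonempty with hrem | ⟨q, hq⟩
    · have e1 : hatPhi ℓ i lam = _ :=
        s10_phi_gen (fun p => (s10_ladder_total ℓ p p).elim id id) hrem
      have e2 : phi ℓ i lam = _ := s10_phi_gen (le := RowLE) (fun p => le_refl _) hrem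
      rw [e1, e2, s10_hat_iter hℓ hrem, s10_tilde_iter hℓ hrem]
    · have hadd : AddableRes ℓ i lam = ∅ := by
        ext p
        simp only [Set.mem_empty_iff_false, iff_false]
        exact fun hp => s10_no_mix hℓ hcl hp hq
      have e1 : hatPhi ℓ i lam = 0 := s10_phi_zero hadd
      have e2 : phi ℓ i lam = 0 := s10_phi_zero (le := RowLE) hadd
      rw [e1, e2]
      rfl
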